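/- Let σ : ℕ → (0,∞) and Δ : ℕ → ℝ be sequences with Δ(m) ≥ m^{1/4}(log m)² for all sufficiently large m and Δ(m)·(log m)/m → 0 as m → ∞, and set q(m) = m·⌈σ(m)²·(15 (m^{3/2}/Δ(m)²) log m + (log m)²)⌉. Then there exists, for each m, a measurable allocation rule mapping the observation vector (consisting of q(m)/m i.i.d. N(μ^ν_i, σ(m)²) samples for each item i ∈ {1,…,m} and each agent ν ∈ {a,b}, all samples mutually independent) to an allocation of the m items, such that inf over all utility profiles μ^a, μ^b ∈ [0,1]^m with OptEnvy ≤ −Δ(m) of the probability that the output allocation A satisfies Envy(A) ≤ 0 tends to 1 as m → ∞. -/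

import Mathlib

open MeasureTheory ProbabilityTheory Real Filter
open scoped ENNReal NNReal Classical

noncomputable section

def envyAB {m : ℕ} (μa : Fin m → ℝ) (A : Finset (Fin m)) : ℝ :=
  ∑ i ∈ Aᶜ, μa i - ∑ i ∈ A, μa i

def envyBA {m : ℕ} (μb : Fin m → ℝ) (A : Finset (Fin m)) : ℝ :=
  ∑ i ∈ A, μb i - ∑ i ∈ Aᶜ, μb i

def envy {m : ℕ} (μa μb : Fin m → ℝ) (A : Finset (Fin m)) : ℝ :=
  max (envyAB μa A) (envyBA μb A)

def optEnvy {m : ℕ} (μa μb : Fin m → ℝ) : ℝ :=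
  ⨅ A : Finset (Fin m), envy μa μb A

/-- The joint law of the observation vector: for each item `i : Fin m`, agent `ν : Bool`
(`true` = agent a, `false` = agent b) and repetition `t : Fin τ`, the sample
`ω (i, ν, t)` is `N(μ^ν_i, v)`, all mutually independent. -/
def obsMeasure (m τ : ℕ) (v : ℝ≥0) (μa μb : Fin m → ℝ) :
    Measure ((Fin m × Bool × Fin τ) → ℝ) :=
  Measure.pi fun p => gaussianReal (if p.2.1 then μa p.1 else μb p.1) v

/-- sign, with value `-1` at `0` -/
def sg (t : ℝ) : ℝ := if 0 < t then 1 else -1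

lemma sg_cases (t : ℝ) : sg t = 1 ∨ sg t = -1 := by unfold sg; split_ifs <;> simp

lemma abs_sg (t : ℝ) : |sg t| = 1 := by rcases sg_cases t with h | h <;> simp [h]

lemma measurable_sg : Measurable sg := by
  unfold sg
  exact Measurable.ite measurableSet_Ioi measurable_const measurable_const

/-- the weight profile -/
def wt (m n : ℕ) (i : Fin m) : ℝ := (((n + i.val) / m : ℕ) : ℝ) / m

def kap (m n : ℕ) : ℝ := ((n / m : ℕ) : ℝ) / m

def tg (w a b : ℝ) : ℝ := w * a - (1 - w) * b
def th (w a b : ℝ) : ℝ := (1 - w) * a + w * b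

def xs (m n : ℕ) (y : Fin m × Bool → ℝ) (i : Fin m) : ℝ :=
  sg (tg (wt m n i) (y (i, true)) (y (i, false)))

def Dh (m : ℕ) (G : ℝ) (n : ℕ) (y : Fin m × Bool → ℝ) : ℝ :=
  ∑ i, xs m n y i * th (wt m n i) (y (i, true)) (y (i, false)) - (1 - 2 * kap m n) * G

def Nsel (m : ℕ) (G : ℝ) (y : Fin m × Bool → ℝ) : ℕ :=
  if h : ∃ n, n ≤ m ^ 2 ∧ 0 ≤ Dh m G n y then Nat.find h else m ^ 2

def allocN (m n : ℕ) (y : Fin m × Bool → ℝ) : Finset (Fin m) :=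
  Finset.univ.filter fun i => 0 < tg (wt m n i) (y (i, true)) (y (i, false))

def allocY (m : ℕ) (G : ℝ) (y : Fin m × Bool → ℝ) : Finset (Fin m) :=
  allocN m (Nsel m G y) y

lemma kap_le_wt (m n : ℕ) (i : Fin m) : kap m n ≤ wt m n i := by
  unfold kap wt
  gcongr
  omega

lemma wt_le_kap (m n : ℕ) (i : Fin m) : wt m n i ≤ kap m n + 1 / m := by
  have hm : 0 < m := i.pos
  unfold kap wt
  rw [← add_div]
  gcongr
  have : (n + i.val) / m ≤ n / m + 1 := by
    have := Nat.div_le_div_right (c := m) (show n + i.val ≤ n + m by omega)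
    rwa [Nat.add_div_right _ hm] at this
  exact_mod_cast this

lemma kap_nonneg (m n : ℕ) : 0 ≤ kap m n := by unfold kap; positivity

lemma kap_le_one (m n : ℕ) (h : n ≤ m ^ 2) : kap m n ≤ 1 := by
  unfold kap
  apply div_le_one_of_le₀ _ (by positivity)
  have : n / m ≤ m := by
    apply Nat.div_le_of_le_mul; nlinarith
  exact_mod_cast this

lemma wt_nonneg (m n : ℕ) (i : Fin m) : 0 ≤ wt m n i := by unfold wt; positivity

lemma wt_le_one (m n : ℕ) (h : n ≤ m ^ 2) (i : Fin m) : wt m n i ≤ 1 := by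
  unfold wt
  apply div_le_one_of_le₀ _ (by positivity)
  have : (n + i.val) / m ≤ m := by
    have hi := i.isLt
    have : (n + i.val) / m < m + 1 := by
      apply Nat.div_lt_of_lt_mul; nlinarith
    omega
  exact_mod_cast this

lemma kap_step (m n : ℕ) (hm : 0 < m) : kap m (n + 1) ≤ kap m n + 1 / m := by
  unfold kap
  rw [← add_div]
  gcongr
  have : (n + 1) / m ≤ n / m + 1 := by
    have := Nat.div_le_div_right (c := m) (show n + 1 ≤ n + m by omega)
    rwa [Nat.add_div_right _ hm] at this
  exact_mod_cast this

/-- At each step at most one weight changes. -/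
lemma wt_step (m n : ℕ) (i j : Fin m) (hi : wt m (n + 1) i ≠ wt m n i)
    (hj : wt m (n + 1) j ≠ wt m n j) : i = j := by
  have key : ∀ k : Fin m, wt m (n + 1) k ≠ wt m n k → m ∣ n + 1 + k.val := by
    intro k hk
    by_contra hd
    apply hk
    unfold wt
    have : (n + 1 + k.val) / m = (n + k.val) / m := by
      rw [show n + 1 + k.val = (n + k.val) + 1 by ring] at hd ⊢
      exact Nat.succ_div_of_not_dvd hd
    rw [this]
  have h1 := key i hi
  have h2 := key j hj
  have hi' := i.isLt
  have hj' := j.isLt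
  ext
  have : n + 1 + i.val ≡ n + 1 + j.val [MOD m] := by
    unfold Nat.ModEq
    rw [Nat.mod_eq_zero_of_dvd h1, Nat.mod_eq_zero_of_dvd h2]
  have := Nat.ModEq.add_left_cancel' _ this
  unfold Nat.ModEq at this
  rwa [Nat.mod_eq_of_lt hi', Nat.mod_eq_of_lt hj'] at this

lemma tg_diff {w κ a b e : ℝ} (h1 : κ ≤ w) (h2 : w ≤ κ + e) (ha : a ∈ Set.Icc (0:ℝ) 1)
    (hb : b ∈ Set.Icc (0:ℝ) 1) : |tg w a b - tg κ a b| ≤ 2 * e := by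
  have : tg w a b - tg κ a b = (w - κ) * (a + b) := by unfold tg; ring
  rw [this, abs_of_nonneg (mul_nonneg (by linarith) (by linarith [ha.1, hb.1]))]
  nlinarith [ha.1, ha.2, hb.1, hb.2]

lemma th_diff {w κ a b e : ℝ} (h1 : κ ≤ w) (h2 : w ≤ κ + e) (ha : a ∈ Set.Icc (0:ℝ) 1)
    (hb : b ∈ Set.Icc (0:ℝ) 1) : |th w a b - th κ a b| ≤ e := by
  have : th w a b - th κ a b = (w - κ) * (b - a) := by unfold th; ring
  rw [this, abs_mul, abs_of_nonneg (by linarith : 0 ≤ w - κ)]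
  have : |b - a| ≤ 1 := abs_le.2 ⟨by linarith [ha.2, hb.1], by linarith [ha.1, hb.2]⟩
  nlinarith [abs_nonneg (b - a)]

lemma th_mem {w a b : ℝ} (h1 : 0 ≤ w) (h2 : w ≤ 1) (ha : a ∈ Set.Icc (0:ℝ) 1)
    (hb : b ∈ Set.Icc (0:ℝ) 1) : |th w a b| ≤ 1 := by
  unfold th
  rw [abs_of_nonneg]
  · nlinarith [ha.2, hb.2]
  · nlinarith [ha.1, hb.1]

lemma abs_tg_le {w a b : ℝ} (h1 : 0 ≤ w) (h2 : w ≤ 1) (ha : a ∈ Set.Icc (0:ℝ) 1)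
    (hb : b ∈ Set.Icc (0:ℝ) 1) : |tg w a b| ≤ 1 := by
  unfold tg
  rw [abs_le]
  constructor <;> nlinarith [ha.1, hb.1, ha.2, hb.2]

lemma sum_diff_le {m : ℕ} (hm : 0 < m) (x f g : Fin m → ℝ) (hx : ∀ i, |x i| = 1) (e : ℝ)
    (h : ∀ i, |f i - g i| ≤ e / m) : |∑ i, x i * f i - ∑ i, x i * g i| ≤ e := by
  rw [← Finset.sum_sub_distrib]
  refine (Finset.abs_sum_le_sum_abs _ _).trans ?_
  have : ∀ i ∈ Finset.univ, |x i * f i - x i * g i| ≤ e / m := by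
    intro i _
    rw [← mul_sub, abs_mul, hx, one_mul]; exact h i
  refine (Finset.sum_le_card_nsmul _ _ _ this).trans ?_
  have : (m:ℝ) ≠ 0 := by positivity
  simp only [Finset.card_univ, Fintype.card_fin, nsmul_eq_mul]
  rw [mul_div_cancel₀ _ this]

lemma Hw_step {m n : ℕ} (hn : n + 1 ≤ m ^ 2) (y : Fin m × Bool → ℝ) (a b : Fin m → ℝ)
    (ha : ∀ i, a i ∈ Set.Icc (0:ℝ) 1) (hb : ∀ i, b i ∈ Set.Icc (0:ℝ) 1) :
    ∑ i, xs m (n+1) y i * th (wt m (n+1) i) (a i) (b i)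
      ≤ ∑ i, xs m n y i * th (wt m n i) (a i) (b i) + 2 := by
  by_cases hall : ∀ i, wt m (n+1) i = wt m n i
  · have : ∑ i, xs m (n+1) y i * th (wt m (n+1) i) (a i) (b i)
      = ∑ i, xs m n y i * th (wt m n i) (a i) (b i) := by
      apply Finset.sum_congr rfl; intro i _; unfold xs; rw [hall i]
    linarith
  · push Not at hall
    obtain ⟨j, hj⟩ := hall
    have hne : ∀ i, i ≠ j → wt m (n+1) i = wt m n i := by
      intro i hi; by_contra h; exact hi (wt_step m n i j h hj)
    rw [← Finset.add_sum_erase _ _ (Finset.mem_univ j),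
      ← Finset.add_sum_erase (a := j) Finset.univ (fun i => xs m n y i * th (wt m n i) (a i) (b i))
        (Finset.mem_univ j)]
    have : ∑ i ∈ Finset.univ.erase j, xs m (n+1) y i * th (wt m (n+1) i) (a i) (b i)
      = ∑ i ∈ Finset.univ.erase j, xs m n y i * th (wt m n i) (a i) (b i) := by
      apply Finset.sum_congr rfl; intro i hi; unfold xs; rw [hne i (Finset.ne_of_mem_erase hi)]
    have h1 : |xs m (n+1) y j * th (wt m (n+1) j) (a j) (b j)| ≤ 1 := by
      rw [abs_mul, xs, abs_sg, one_mul]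
      exact th_mem (wt_nonneg _ _ _) (wt_le_one _ _ hn _) (ha j) (hb j)
    have h2 : |xs m n y j * th (wt m n j) (a j) (b j)| ≤ 1 := by
      rw [abs_mul, xs, abs_sg, one_mul]
      exact th_mem (wt_nonneg _ _ _) (wt_le_one _ _ (by omega) _) (ha j) (hb j)
    rw [abs_le] at h1 h2
    linarith

lemma envyAB_allocN {m n : ℕ} (y : Fin m × Bool → ℝ) (a : Fin m → ℝ) :
    envyAB a (allocN m n y) = - ∑ i, xs m n y i * a i := by
  unfold envyAB
  rw [← Finset.sum_add_sum_compl (allocN m n y) (fun i => xs m n y i * a i)]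
  have h1 : ∑ i ∈ allocN m n y, xs m n y i * a i = ∑ i ∈ allocN m n y, a i := by
    apply Finset.sum_congr rfl
    intro i hi
    simp only [allocN, Finset.mem_filter, Finset.mem_univ, true_and] at hi
    simp [xs, sg, hi]
  have h2 : ∑ i ∈ (allocN m n y)ᶜ, xs m n y i * a i = - ∑ i ∈ (allocN m n y)ᶜ, a i := by
    rw [← Finset.sum_neg_distrib]
    apply Finset.sum_congr rfl
    intro i hi
    simp only [allocN, Finset.mem_compl, Finset.mem_filter, Finset.mem_univ, true_and] at hi
    simp [xs, sg, hi]
  rw [h1, h2]; ring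

lemma envyBA_eq {m : ℕ} (b : Fin m → ℝ) (A : Finset (Fin m)) : envyBA b A = - envyAB b A := by
  unfold envyBA envyAB; ring

/-- Deterministic part: on the good event the selected allocation is envy-free. -/
lemma det_good {m : ℕ} (hm : 32 ≤ m) (G : ℝ) (hG : 48 ≤ G) (y : Fin m × Bool → ℝ)
    (a b : Fin m → ℝ)
    (ha : ∀ i, a i ∈ Set.Icc (0:ℝ) 1) (hb : ∀ i, b i ∈ Set.Icc (0:ℝ) 1)
    (hW : ∀ n ≤ m ^ 2, G ≤ ∑ i, xs m n y i * tg (wt m n i) (a i) (b i))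
    (hH : ∀ n ≤ m ^ 2, |∑ i, xs m n y i * (th (wt m n i) (y (i, true)) (y (i, false))
        - th (wt m n i) (a i) (b i))| ≤ G / 8) :
    envy a b (allocY m G y) ≤ 0 := by
  have hm0 : 0 < m := by omega
  have hmR : (32:ℝ) ≤ m := by exact_mod_cast hm
  have hN : Nsel m G y ≤ m ^ 2 := by
    unfold Nsel
    split_ifs with h
    · exact (Nat.find_spec h).1
    · exact le_rfl
  have hDn : ∀ n ≤ m ^ 2, |Dh m G n y + (1 - 2 * kap m n) * G
      - ∑ i, xs m n y i * th (wt m n i) (a i) (b i)| ≤ G / 8 := by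
    intro n hn
    have := hH n hn
    unfold Dh
    simp only [mul_sub, Finset.sum_sub_distrib] at this
    convert this using 2
    ring
  -- lower bound or at the end
  have hlow : 0 ≤ Dh m G (Nsel m G y) y ∨ Nsel m G y = m ^ 2 := by
    unfold Nsel
    split_ifs with h
    · left; exact (Nat.find_spec h).2
    · right; rfl
  have hup : Nsel m G y = 0 ∨ Dh m G (Nsel m G y) y < 0 ∨
      ∃ n, Nsel m G y = n + 1 ∧ Dh m G n y < 0 := by
    by_cases h : ∃ n, n ≤ m ^ 2 ∧ 0 ≤ Dh m G n y
    · have he : Nsel m G y = Nat.find h := by unfold Nsel; rw [dif_pos h]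
      rcases Nat.eq_zero_or_pos (Nat.find h) with h0 | h0
      · left; rw [he, h0]
      · right; right
        refine ⟨Nat.find h - 1, by omega, ?_⟩
        have := Nat.find_min h (show Nat.find h - 1 < Nat.find h by omega)
        by_contra hc
        push Not at hc
        exact this ⟨by rw [he] at hN; omega, hc⟩
    · right; left
      have he : Nsel m G y = m ^ 2 := by unfold Nsel; rw [dif_neg h]
      push Not at h
      rw [he]; exact h _ le_rfl
  generalize hNe : Nsel m G y = N at *
  have halloc : allocY m G y = allocN m N y := by unfold allocY; rw [hNe]
  rw [halloc]
  set κ := kap m N with hκ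
  have hκ0 : 0 ≤ κ := kap_nonneg m N
  have hκ1 : κ ≤ 1 := kap_le_one m N hN
  have hx : ∀ i, |xs m N y i| = 1 := fun i => abs_sg _
  have hWd := sum_diff_le hm0 (xs m N y) (fun i => tg (wt m N i) (a i) (b i))
    (fun i => tg κ (a i) (b i)) hx 2 (fun i => by
      have := tg_diff (kap_le_wt m N i) (wt_le_kap m N i) (ha i) (hb i)
      calc _ ≤ _ := this
        _ = _ := by ring)
  have hHd := sum_diff_le hm0 (xs m N y) (fun i => th (wt m N i) (a i) (b i))
    (fun i => th κ (a i) (b i)) hx 1 (fun i =>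
      th_diff (kap_le_wt m N i) (wt_le_kap m N i) (ha i) (hb i))
  set U := ∑ i, xs m N y i * a i with hU
  set V := - ∑ i, xs m N y i * b i with hV
  have hWUV : ∑ i, xs m N y i * tg κ (a i) (b i) = κ * U + (1 - κ) * V := by
    rw [hU, hV, mul_neg, Finset.mul_sum, Finset.mul_sum, ← sub_eq_add_neg,
      ← Finset.sum_sub_distrib]
    apply Finset.sum_congr rfl; intro i _; unfold tg; ring
  have hHUV : ∑ i, xs m N y i * th κ (a i) (b i) = (1 - κ) * U - κ * V := by
    rw [hU, hV, mul_neg, Finset.mul_sum, Finset.mul_sum, sub_neg_eq_add,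
      ← Finset.sum_add_distrib]
    apply Finset.sum_congr rfl; intro i _; unfold th; ring
  rw [hWUV] at hWd
  rw [hHUV] at hHd
  have hWN := hW N hN
  have hDN := hDn N hN
  rw [abs_le] at hWd hHd hDN
  have hWk : G - 2 ≤ κ * U + (1 - κ) * V := by linarith
  have hUge : 0 ≤ U := by
    rcases hlow with h | h
    · have h1 : (1 - 2 * κ) * G - G / 8 - 1 ≤ (1 - κ) * U - κ * V := by linarith
      have h2 : 0 ≤ (κ ^ 2 + (1 - κ) ^ 2) * U := by
        have e : (κ ^ 2 + (1 - κ) ^ 2) * U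
          = κ * (κ * U + (1 - κ) * V) + (1 - κ) * ((1 - κ) * U - κ * V) := by ring
        rw [e]
        have e1 := mul_le_mul_of_nonneg_left hWk hκ0
        have e2 := mul_le_mul_of_nonneg_left h1 (sub_nonneg.2 hκ1)
        nlinarith [mul_nonneg (sq_nonneg (2 * κ - 1)) (by linarith : 0 ≤ G)]
      exact (mul_nonneg_iff_of_pos_left (by nlinarith [sq_nonneg (2 * κ - 1)])).1 h2
    · have : κ = 1 := by
        rw [hκ, h]; unfold kap
        rw [pow_two, Nat.mul_div_cancel _ hm0]
        field_simp
      rw [this] at hWk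
      linarith
  have hVge : 0 ≤ V := by
    have main : (N = 0) ∨ (1 - κ) * U - κ * V ≤ (1 - 2 * κ) * G + G / 4 := by
      rcases hup with h | h | ⟨n, hn, h⟩
      · left; exact h
      · right; linarith
      · right
        have h1 := hDn n (by omega)
        have h2 := Hw_step (m := m) (n := n) (by omega) y a b ha hb
        rw [← hn] at h2
        rw [abs_le] at h1
        have h3 : κ ≤ kap m n + 1 / m := by rw [hκ, hn]; exact kap_step m n hm0
        have h4 : (1:ℝ) / m ≤ 1 / 32 := by
          apply one_div_le_one_div_of_le <;> linarith
        have h5 : (κ - kap m n) * G ≤ 1 / 32 * G :=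
          mul_le_mul_of_nonneg_right (by linarith) (by linarith)
        linarith
    rcases main with h | h
    · have : κ = 0 := by
        rw [hκ, h]; unfold kap; simp
      rw [this] at hWk
      linarith
    · have h2 : 0 ≤ (κ ^ 2 + (1 - κ) ^ 2) * V := by
        have e : (κ ^ 2 + (1 - κ) ^ 2) * V
          = (1 - κ) * (κ * U + (1 - κ) * V) - κ * ((1 - κ) * U - κ * V) := by ring
        rw [e]
        have e1 := mul_le_mul_of_nonneg_left hWk (sub_nonneg.2 hκ1)
        have e2 := mul_le_mul_of_nonneg_left h hκ0
        nlinarith [mul_nonneg (sq_nonneg (2 * κ - 1)) (by linarith : 0 ≤ G)]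
      exact (mul_nonneg_iff_of_pos_left (by nlinarith [sq_nonneg (2 * κ - 1)])).1 h2
  unfold envy
  rw [envyBA_eq, envyAB_allocN, envyAB_allocN]
  apply max_le <;> linarith

/-- Weak duality. -/
lemma sum_tg_ge {m : ℕ} (hm : 0 < m) (Δ : ℝ) (a b : Fin m → ℝ)
    (ha : ∀ i, a i ∈ Set.Icc (0:ℝ) 1) (hb : ∀ i, b i ∈ Set.Icc (0:ℝ) 1)
    (hopt : optEnvy a b ≤ -Δ) (n : ℕ) (hn : n ≤ m ^ 2) :
    Δ - 2 ≤ ∑ i, |tg (wt m n i) (a i) (b i)| := by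
  obtain ⟨A, hA⟩ := exists_eq_ciInf_of_finite (f := fun A : Finset (Fin m) => envy a b A)
  have hA' : envy a b A ≤ -Δ := by rw [hA]; exact hopt
  have h1 : envyAB a A ≤ -Δ := (le_max_left _ _).trans hA'
  have h2 : envyBA b A ≤ -Δ := (le_max_right _ _).trans hA'
  rw [envyBA_eq] at h2
  let x : Fin m → ℝ := fun i => if i ∈ A then 1 else -1
  have hx : ∀ i, |x i| = 1 := by intro i; simp only [x]; split_ifs <;> simp
  have hs : ∀ c : Fin m → ℝ, envyAB c A = - ∑ i, x i * c i := by
    intro c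
    unfold envyAB
    rw [← Finset.sum_add_sum_compl A (fun i => x i * c i)]
    have e1 : ∑ i ∈ A, x i * c i = ∑ i ∈ A, c i := by
      apply Finset.sum_congr rfl; intro i hi; simp [x, hi]
    have e2 : ∑ i ∈ Aᶜ, x i * c i = - ∑ i ∈ Aᶜ, c i := by
      rw [← Finset.sum_neg_distrib]
      apply Finset.sum_congr rfl; intro i hi; simp [x, Finset.mem_compl.1 hi]
    rw [e1, e2]; ring
  rw [hs] at h1 h2
  set κ := kap m n with hκ
  have hκ0 : 0 ≤ κ := kap_nonneg m n
  have hκ1 : κ ≤ 1 := kap_le_one m n hn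
  have hWd := sum_diff_le hm x (fun i => tg (wt m n i) (a i) (b i))
    (fun i => tg κ (a i) (b i)) hx 2 (fun i => by
      have := tg_diff (kap_le_wt m n i) (wt_le_kap m n i) (ha i) (hb i)
      calc _ ≤ _ := this
        _ = _ := by ring)
  have hWUV : ∑ i, x i * tg κ (a i) (b i) = κ * ∑ i, x i * a i - (1 - κ) * ∑ i, x i * b i := by
    rw [Finset.mul_sum, Finset.mul_sum, ← Finset.sum_sub_distrib]
    apply Finset.sum_congr rfl; intro i _; unfold tg; ring
  rw [hWUV, abs_le] at hWd
  have h3 : ∑ i, x i * tg (wt m n i) (a i) (b i) ≤ ∑ i, |tg (wt m n i) (a i) (b i)| := by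
    apply Finset.sum_le_sum; intro i _
    refine (le_abs_self _).trans ?_
    rw [abs_mul, hx, one_mul]
  nlinarith
lemma gauss_chebyshev (g : ℝ) (u : ℝ≥0) (B : Set ℝ) (hB : ∀ t ∈ B, |g| ≤ |t - g|) :
    |g| ^ 2 * (gaussianReal g u).real B ≤ u := by
  by_cases hg : g = 0
  · simp [hg]
  have hr : 0 < |g| := abs_pos.2 hg
  have h := meas_ge_le_variance_div_sq (μ := gaussianReal g u) (X := id)
    (memLp_id_gaussianReal' 2 (by simp)) hr
  rw [variance_id_gaussianReal] at h
  have hsub : B ⊆ {ω | |g| ≤ |id ω - ∫ x, id x ∂(gaussianReal g u)|} := by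
    intro t ht
    simp only [id, integral_id_gaussianReal, Set.mem_ofPred_eq]
    exact hB t ht
  have h2 : (gaussianReal g u).real B ≤ u / |g| ^ 2 := by
    rw [measureReal_def]
    refine ENNReal.toReal_le_of_le_ofReal (by positivity) ((measure_mono hsub).trans h)
  calc _ ≤ |g| ^ 2 * (u / |g| ^ 2) := by gcongr
    _ = u := by field_simp

lemma wrong_prop {g t : ℝ} (h : sg t * g < 0) : |g| ≤ |t - g| := by
  unfold sg at h
  split_ifs at h with h1
  · have : g < 0 := by linarith
    rw [abs_of_neg this, abs_of_pos (by linarith)]; linarith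
  · have : 0 < g := by linarith
    rw [abs_of_pos this, abs_of_nonpos (by linarith)]; linarith

lemma meas_wrong (g : ℝ) : MeasurableSet {t : ℝ | sg t * g < 0} :=
  measurableSet_lt (measurable_sg.mul_const g) measurable_const

lemma gauss_symm (g : ℝ) (u : ℝ≥0) :
    2 * (gaussianReal g u).real {t | sg t * g < 0} + (gaussianReal g u).real {t | |t - g| < |g|}
      ≤ 1 := by
  set B := {t : ℝ | sg t * g < 0} with hB
  set B' := (fun t => 2 * g - t) ⁻¹' B with hB'
  set M := {t : ℝ | |t - g| < |g|} with hM
  have hmB : MeasurableSet B := meas_wrong g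
  have hmf : Measurable (fun t : ℝ => 2 * g - t) := by fun_prop
  have hmB' : MeasurableSet B' := hmf hmB
  have hmM : MeasurableSet M := measurableSet_lt (by fun_prop) measurable_const
  have he : (gaussianReal g u).real B' = (gaussianReal g u).real B := by
    have := gaussianReal_map_const_sub (μ := g) (v := u) (2 * g)
    rw [show 2 * g - g = g by ring] at this
    conv_rhs => rw [← this]
    rw [map_measureReal_apply hmf hmB]
  have d1 : Disjoint B M := by
    rw [Set.disjoint_left]; intro t h1 h2
    have := wrong_prop h1
    simp only [hM, Set.mem_ofPred_eq] at h2
    linarith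
  have d2 : Disjoint B' M := by
    rw [Set.disjoint_left]; intro t h1 h2
    have := wrong_prop h1
    rw [show 2 * g - t - g = -(t - g) by ring, abs_neg] at this
    simp only [hM, Set.mem_ofPred_eq] at h2
    linarith
  have d3 : Disjoint B B' := by
    rw [Set.disjoint_left]; intro t h1 h2
    simp only [hB, hB', Set.mem_preimage, Set.mem_ofPred_eq] at h1 h2
    unfold sg at h1 h2
    split_ifs at h1 h2 <;> linarith
  have hu : (gaussianReal g u).real ((B ∪ B') ∪ M) =
      (gaussianReal g u).real B + (gaussianReal g u).real B' + (gaussianReal g u).real M := by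
    rw [measureReal_union (Disjoint.union_left d1 d2) hmM, measureReal_union d3 hmB']
  have := measureReal_le_one (μ := gaussianReal g u) (s := (B ∪ B') ∪ M)
  rw [hu, he] at this
  linarith

lemma gauss_anti (g S : ℝ) (u : ℝ≥0) (hu : u ≠ 0) (hS : 0 < S) (huS : (u : ℝ) ≤ S ^ 2) :
    1 / 3 * min (|g| / S) 1 ≤ (gaussianReal g u).real {t | |t - g| < |g|} := by
  have hu0 : (0:ℝ) < u := by
    have := pos_iff_ne_zero.2 hu
    exact_mod_cast this
  set s := √(u:ℝ) with hs
  have hs0 : 0 < s := Real.sqrt_pos.2 hu0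
  have hss : s ^ 2 = u := Real.sq_sqrt hu0.le
  have hsS : s ≤ S := by
    rw [hs]; exact Real.sqrt_le_iff.2 ⟨hS.le, huS⟩
  set ρ := min |g| s with hρ
  have hρ0 : 0 ≤ ρ := le_min (abs_nonneg _) hs0.le
  have hlow : 1 / 3 * min (|g| / S) 1 ≤ 1 / 3 * (ρ / s) := by
    gcongr
    rw [hρ, ← min_div_div_right hs0.le, div_self hs0.ne']
    gcongr
  refine hlow.trans ?_
  have hsub : Set.Ioo (g - ρ) (g + ρ) ⊆ {t | |t - g| < |g|} := by
    intro t ht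
    simp only [Set.mem_ofPred_eq]
    refine lt_of_lt_of_le ?_ (min_le_left |g| s)
    rw [abs_lt]; constructor <;> linarith [ht.1, ht.2]
  have hI : (gaussianReal g u).real (Set.Ioo (g - ρ) (g + ρ))
      = ∫ x in Set.Ioo (g - ρ) (g + ρ), gaussianPDFReal g u x := by
    rw [measureReal_def, gaussianReal_apply_eq_integral _ hu, ENNReal.toReal_ofReal]
    exact integral_nonneg (fun x => gaussianPDFReal_nonneg _ _ _)
  refine le_trans ?_ (measureReal_mono hsub)
  rw [hI]
  have hc : ∀ x ∈ Set.Ioo (g - ρ) (g + ρ), 1 / (6 * s) ≤ gaussianPDFReal g u x := by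
    intro x hx
    rw [gaussianPDFReal]
    have h1 : (x - g) ^ 2 ≤ u := by
      rw [← hss]
      have : |x - g| ≤ s := by
        refine le_trans ?_ (min_le_right |g| s)
        rw [abs_le]; constructor <;> linarith [hx.1, hx.2]
      rw [← sq_abs]; gcongr
    have h2 : (1:ℝ)/2 ≤ Real.exp (-(x - g) ^ 2 / (2 * u)) := by
      have h3 : -(1/2 : ℝ) ≤ -(x - g) ^ 2 / (2 * u) := by
        rw [le_div_iff₀ (by positivity)]; linarith
      have := Real.add_one_le_exp (-(x - g) ^ 2 / (2 * u))
      linarith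
    have h4 : √(2 * π * u) ≤ 3 * s := by
      rw [Real.sqrt_le_iff]
      refine ⟨by positivity, ?_⟩
      rw [mul_pow, hss]
      nlinarith [Real.pi_lt_four]
    have h5 : 0 < √(2 * π * u) := Real.sqrt_pos.2 (by positivity)
    calc 1 / (6 * s) = (3 * s)⁻¹ * (1 / 2) := by field_simp; norm_num
      _ ≤ _ := by gcongr
  have := setIntegral_mono_on (μ := volume) (s := Set.Ioo (g - ρ) (g + ρ))
    (f := fun _ => 1 / (6 * s)) (g := gaussianPDFReal g u)
    (integrableOn_const (by simp)) ((integrable_gaussianPDFReal g u).integrableOn) measurableSet_Ioo hc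
  refine le_trans (le_of_eq ?_) this
  rw [setIntegral_const, measureReal_def, Real.volume_Ioo, ENNReal.toReal_ofReal (by linarith)]
  simp only [smul_eq_mul]
  field_simp
  ring

lemma min_quad {r S α : ℝ} (hr : 0 ≤ r) (hS : 0 < S) (hα' : α ≤ 1 / 2) :
    2 * α * r - α ^ 2 * S ≤ r * min (r / S) 1 := by
  rcases min_cases (r / S) 1 with ⟨h, _⟩ | ⟨h, _⟩
  · rw [h, ← mul_div_assoc, le_div_iff₀ hS]
    nlinarith [sq_nonneg (r - α * S)]
  · rw [h]
    nlinarith [mul_nonneg (sq_nonneg α) hS.le]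

lemma gauss_sg_mgf (g S α θ : ℝ) (u : ℝ≥0) (hu : u ≠ 0) (hS : 0 < S) (huS : (u : ℝ) ≤ S ^ 2)
    (hg : |g| ≤ 1) (hα' : α ≤ 1 / 2) (hθ : 0 ≤ θ) (hθ' : θ ≤ 1 / 2) :
    ∫ t, Real.exp (-θ * (sg t * g)) ∂(gaussianReal g u)
      ≤ Real.exp (-θ / 3 * (2 * α * |g| - α ^ 2 * S) + 4 * θ ^ 2 * S ^ 2) := by
  set r := |g| with hr
  have hr0 : 0 ≤ r := abs_nonneg g
  set B := {t : ℝ | sg t * g < 0} with hB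
  set q := (gaussianReal g u).real B with hq
  have hq0 : 0 ≤ q := measureReal_nonneg
  have hfun : ∀ t, Real.exp (-θ * (sg t * g)) = Real.exp (-θ * r)
      + B.indicator (fun _ => Real.exp (θ * r) - Real.exp (-θ * r)) t := by
    intro t
    by_cases ht : t ∈ B
    · rw [Set.indicator_of_mem ht]
      have h1 : sg t * g = - r := by
        have : |sg t * g| = r := by rw [abs_mul, abs_sg, one_mul]
        rw [abs_of_neg ht] at this; linarith
      rw [h1]; ring_nf
    · rw [Set.indicator_of_notMem ht]
      have h1 : sg t * g = r := by
        have : |sg t * g| = r := by rw [abs_mul, abs_sg, one_mul]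
        rwa [abs_of_nonneg (not_lt.1 ht)] at this
      rw [h1]; ring_nf
  have hIntg : ∫ t, Real.exp (-θ * (sg t * g)) ∂(gaussianReal g u)
      = Real.exp (-θ * r) + q * (Real.exp (θ * r) - Real.exp (-θ * r)) := by
    simp_rw [hfun]
    rw [integral_add (integrable_const _)
      ((integrable_const _).indicator (meas_wrong g)), integral_indicator (meas_wrong g)]
    rw [setIntegral_const, integral_const, probReal_univ, one_smul, smul_eq_mul]
  rw [hIntg]
  have h1 : Real.exp (-θ * r) + q * (Real.exp (θ * r) - Real.exp (-θ * r))
      = Real.exp (-θ * r) * (1 + q * (Real.exp (2 * θ * r) - 1)) := by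
    have : Real.exp (θ * r) = Real.exp (-θ * r) * Real.exp (2 * θ * r) := by
      rw [← Real.exp_add]; ring_nf
    rw [this]; ring
  have hθr : 2 * θ * r ≤ 1 := by nlinarith
  have hθr0 : 0 ≤ 2 * θ * r := by positivity
  have h2 : Real.exp (2 * θ * r) - 1 ≤ 2 * θ * r + (2 * θ * r) ^ 2 := by
    have := Real.abs_exp_sub_one_sub_id_le (x := 2 * θ * r) (by rw [abs_of_nonneg hθr0]; exact hθr)
    rw [abs_le] at this
    linarith
  have h3 : 1 + q * (Real.exp (2 * θ * r) - 1)
      ≤ Real.exp (q * (2 * θ * r + (2 * θ * r) ^ 2)) := by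
    have := Real.add_one_le_exp (q * (2 * θ * r + (2 * θ * r) ^ 2))
    nlinarith [mul_le_mul_of_nonneg_left h2 hq0]
  rw [h1]
  calc _ ≤ Real.exp (-θ * r) * Real.exp (q * (2 * θ * r + (2 * θ * r) ^ 2)) := by gcongr
    _ = Real.exp (-θ * (r * (1 - 2 * q)) + 4 * θ ^ 2 * (r ^ 2 * q)) := by
      rw [← Real.exp_add]; ring_nf
    _ ≤ _ := by
      apply Real.exp_le_exp.2
      have e1 : r ^ 2 * q ≤ S ^ 2 := (gauss_chebyshev g u B (fun t ht => wrong_prop ht)).trans huS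
      have e2 := gauss_symm g u
      have e3 := gauss_anti g S u hu hS huS
      have e4 := min_quad hr0 hS hα'
      have e5 : 1 / 3 * (2 * α * r - α ^ 2 * S) ≤ r * (1 - 2 * q) := by
        have : 1 / 3 * min (r / S) 1 ≤ 1 - 2 * q := by linarith
        have := mul_le_mul_of_nonneg_left this hr0
        linarith
      have e6 := mul_le_mul_of_nonneg_left e5 hθ
      have e7 := mul_le_mul_of_nonneg_left e1 (by positivity : 0 ≤ 4 * θ ^ 2)
      linarith

/-- coefficient functional -/
def lin {ι : Type*} [Fintype ι] (c : ι → ℝ) (ω : ι → ℝ) : ℝ := ∑ p, c p * ω p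

lemma measurable_lin {ι : Type*} [Fintype ι] (c : ι → ℝ) : Measurable (lin c) := by
  unfold lin; fun_prop

section linpart
variable {ι : Type*} [Fintype ι] (μ : ι → ℝ) (v : ℝ≥0)


lemma eval_map (p : ι) : (Measure.pi (fun p => gaussianReal (μ p) v)).map (fun ω => ω p) = gaussianReal (μ p) v :=
  (measurePreserving_eval (fun p => gaussianReal (μ p) v) p).map_eq

lemma eval_gauss (p : ι) : HasGaussianLaw (fun ω : ι → ℝ => ω p) (Measure.pi (fun p => gaussianReal (μ p) v)) where
  isGaussian_map := by rw [eval_map]; infer_instance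

lemma eval_indep : iIndepFun (fun (p : ι) (ω : ι → ℝ) => ω p) (Measure.pi (fun p => gaussianReal (μ p) v)) :=
  iIndepFun_pi (X := fun _ x => x) (fun _ => aemeasurable_id)

lemma joint_gauss : HasGaussianLaw (fun ω : ι → ℝ => fun p => ω p) (Measure.pi (fun p => gaussianReal (μ p) v)) :=
  (eval_indep μ v).hasGaussianLaw (eval_gauss μ v)

lemma eval_mean (p : ι) : ∫ ω, ω p ∂(Measure.pi (fun p => gaussianReal (μ p) v)) = μ p := by
  have h := integral_map (μ := (Measure.pi (fun p => gaussianReal (μ p) v))) (φ := fun ω => ω p) (f := fun x : ℝ => x)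
    (measurable_pi_apply p).aemeasurable (by fun_prop)
  rw [eval_map, integral_id_gaussianReal] at h
  exact h.symm

lemma eval_var (p : ι) : Var[fun ω : ι → ℝ => ω p; (Measure.pi (fun p => gaussianReal (μ p) v))] = v := by
  have h := variance_map (μ := (Measure.pi (fun p => gaussianReal (μ p) v))) (Y := fun ω : ι → ℝ => ω p) (X := fun x : ℝ => x)
    (by fun_prop) (measurable_pi_apply p).aemeasurable
  rw [eval_map, variance_fun_id_gaussianReal] at h
  exact h.symm

lemma lin_mean (c : ι → ℝ) : ∫ ω, lin c ω ∂(Measure.pi (fun p => gaussianReal (μ p) v)) = ∑ p, c p * μ p := by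
  unfold lin
  rw [integral_finsetSum]
  · simp_rw [integral_const_mul, eval_mean]
  · intro p _
    exact (eval_gauss μ v p).integrable.const_mul _

lemma lin_cov (c d : ι → ℝ) : cov[lin c, lin d; (Measure.pi (fun p => gaussianReal (μ p) v))] = v * ∑ p, c p * d p := by
  have e1 : ∀ c : ι → ℝ, lin c = ∑ p, fun ω => c p * ω p := by
    intro c; ext ω; simp [lin]
  rw [e1, e1, covariance_sum_sum]
  · rw [Finset.mul_sum]
    apply Finset.sum_congr rfl
    intro p _
    rw [Finset.sum_eq_single p]
    · rw [covariance_const_mul_left, covariance_const_mul_right, covariance_self (measurable_pi_apply p).aemeasurable,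
        eval_var]; ring
    · intro q _ hq
      rw [covariance_const_mul_left, covariance_const_mul_right,
        ((eval_indep μ v).indepFun hq.symm).covariance_eq_zero]
      · simp
      · exact (eval_gauss μ v p).memLp_two
      · exact (eval_gauss μ v q).memLp_two
    · simp
  · intro p; exact (eval_gauss μ v p).memLp_two.const_mul _
  · intro p; exact (eval_gauss μ v p).memLp_two.const_mul _

lemma lin_joint {κ : Type*} [Fintype κ] (c : κ → ι → ℝ) :
    HasGaussianLaw (fun ω k => lin (c k) ω) (Measure.pi (fun p => gaussianReal (μ p) v)) := by
  let L : (ι → ℝ) →ₗ[ℝ] (κ → ℝ) :=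
    { toFun := fun ω k => lin (c k) ω
      map_add' := by intro x y; ext k; simp [lin, mul_add, Finset.sum_add_distrib]
      map_smul' := by
        intro r x; ext k; simp only [lin, Pi.smul_apply, smul_eq_mul, RingHom.id_apply,
          Finset.mul_sum]
        apply Finset.sum_congr rfl; intros; ring }
  exact (joint_gauss μ v).map (LinearMap.toContinuousLinearMap L)

lemma lin_map (c : ι → ℝ) : (Measure.pi (fun p => gaussianReal (μ p) v)).map (lin c) =
    gaussianReal (∑ p, c p * μ p) (v * ∑ p, c p * c p).toNNReal := by
  have h : HasGaussianLaw (lin c) (Measure.pi (fun p => gaussianReal (μ p) v)) :=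
    (lin_joint μ v (fun _ : Unit => c)).map (ContinuousLinearMap.proj (R := ℝ) ())
  rw [h.map_eq_gaussianReal, lin_mean, ← covariance_self (measurable_lin c).aemeasurable, lin_cov]

lemma lin_indep (c d : ι → ℝ) (h : ∑ p, c p * d p = 0) : IndepFun (lin c) (lin d) (Measure.pi (fun p => gaussianReal (μ p) v)) := by
  have h1 := (lin_joint μ v (fun b : Bool => if b then c else d)).map
    ((ContinuousLinearMap.proj (R := ℝ) (φ := fun _ : Bool => ℝ) true).prod
      (ContinuousLinearMap.proj (R := ℝ) (φ := fun _ : Bool => ℝ) false))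
  have h2 : HasGaussianLaw (fun ω => (lin c ω, lin d ω)) (Measure.pi (fun p => gaussianReal (μ p) v)) := by
    exact h1
  exact h2.indepFun_of_covariance_eq_zero (by rw [lin_cov, h, mul_zero])

lemma lin_blocks {κ : Type*} [Fintype κ] (c : κ → Bool → ι → ℝ)
    (h : ∀ i j, i ≠ j → ∀ k l, ∑ p, c i k p * c j l p = 0) :
    iIndepFun (fun i ω k => lin (c i k) ω) (Measure.pi (fun p => gaussianReal (μ p) v)) := by
  have h1 := lin_joint μ v (fun q : κ × Bool => c q.1 q.2)
  let L : (κ × Bool → ℝ) →ₗ[ℝ] (κ → Bool → ℝ) :=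
    { toFun := fun z i k => z (i, k)
      map_add' := by intro x y; rfl
      map_smul' := by intro r x; rfl }
  have h2 := h1.map (LinearMap.toContinuousLinearMap L)
  refine HasGaussianLaw.iIndepFun_of_covariance_eval (X := fun i k ω => lin (c i k) ω) h2 ?_
  intro i j hij k l
  have := lin_cov μ v (c i k) (c j l)
  rw [h i j hij k l, mul_zero] at this
  exact this
end linpart

lemma mgf_sign {Ω : Type*} [MeasurableSpace Ω] (P : Measure Ω) [IsProbabilityMeasure P]
    (T H : Ω → ℝ) (hT : Measurable T) (hH : Measurable H) (hi : IndepFun T H P)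
    (h : ℝ) (u : ℝ≥0) (hl : P.map H = gaussianReal h u) (θ : ℝ) :
    Integrable (fun ω => exp (θ * (sg (T ω) * (H ω - h)))) P ∧
    mgf (fun ω => sg (T ω) * (H ω - h)) P θ = exp (u * θ ^ 2 / 2) := by
  have hm : ∀ s : ℝ, Integrable (fun ω => exp (s * (H ω - h))) P ∧
      ∫ ω, exp (s * (H ω - h)) ∂P = exp (u * s ^ 2 / 2) := by
    intro s
    have h1 := mgf_gaussianReal hl s
    have h2 : Integrable (fun ω => exp (s * H ω)) P := by
      by_contra hc
      have := mgf_undef hc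
      rw [h1] at this
      exact (exp_pos _).ne' this
    have e : (fun ω => exp (s * (H ω - h))) = fun ω => exp (-(s * h)) * exp (s * H ω) := by
      ext ω; rw [← exp_add]; congr 1; ring
    constructor
    · rw [e]; exact h2.const_mul _
    · have h3 : ∫ ω, exp (s * H ω) ∂P = _ := h1
      rw [e, integral_const_mul, h3, ← exp_add]; congr 1; ring
  let i1 : ℝ → ℝ := fun t => if 0 < t then 1 else 0
  let i2 : ℝ → ℝ := fun t => if 0 < t then 0 else 1
  have mi1 : Measurable i1 := Measurable.ite measurableSet_Ioi measurable_const measurable_const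
  have mi2 : Measurable i2 := Measurable.ite measurableSet_Ioi measurable_const measurable_const
  have e : (fun ω => exp (θ * (sg (T ω) * (H ω - h)))) =
      fun ω => i1 (T ω) * exp (θ * (H ω - h)) + i2 (T ω) * exp ((-θ) * (H ω - h)) := by
    ext ω
    simp only [i1, i2, sg]
    split_ifs
    · simp
    · simp only [zero_mul, one_mul, zero_add]; congr 1; ring
  have bi1 : ∀ t, |i1 t| ≤ 1 := by intro t; simp only [i1]; split_ifs <;> simp
  have bi2 : ∀ t, |i2 t| ≤ 1 := by intro t; simp only [i2]; split_ifs <;> simp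
  have I1 : Integrable (fun ω => i1 (T ω)) P :=
    Integrable.of_bound (mi1.comp hT).aestronglyMeasurable 1
      (Eventually.of_forall fun ω => by simpa using bi1 (T ω))
  have I2 : Integrable (fun ω => i2 (T ω)) P :=
    Integrable.of_bound (mi2.comp hT).aestronglyMeasurable 1
      (Eventually.of_forall fun ω => by simpa using bi2 (T ω))
  have ind1 : IndepFun (fun ω => i1 (T ω)) (fun ω => exp (θ * (H ω - h))) P :=
    hi.comp (φ := i1) (ψ := fun x => exp (θ * (x - h))) mi1 (by fun_prop)
  have ind2 : IndepFun (fun ω => i2 (T ω)) (fun ω => exp ((-θ) * (H ω - h))) P :=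
    hi.comp (φ := i2) (ψ := fun x => exp ((-θ) * (x - h))) mi2 (by fun_prop)
  have J1 := ind1.integrable_mul I1 (hm θ).1
  have J2 := ind2.integrable_mul I2 (hm (-θ)).1
  constructor
  · rw [e]; exact J1.add J2
  · unfold mgf
    rw [e]
    have := integral_add J1 J2
    simp only [Pi.mul_apply] at this
    rw [this, ind1.integral_fun_mul_eq_mul_integral I1.1 (hm θ).1.1,
      ind2.integral_fun_mul_eq_mul_integral I2.1 (hm (-θ)).1.1, (hm θ).2, (hm (-θ)).2]
    have h1 : ∫ ω, i1 (T ω) ∂P + ∫ ω, i2 (T ω) ∂P = 1 := by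
      rw [← integral_add I1 I2]
      have : (fun ω => i1 (T ω) + i2 (T ω)) = fun _ => (1:ℝ) := by
        ext ω; simp only [i1, i2]; split_ifs <;> simp
      rw [this]; simp
    rw [neg_sq, ← add_mul, h1, one_mul]

lemma chernoff_sum {Ω : Type*} [MeasurableSpace Ω] (P : Measure Ω) [IsProbabilityMeasure P]
    {m : ℕ} (X : Fin m → Ω → ℝ) (hX : ∀ i, Measurable (X i)) (hi : iIndepFun X P) (θ ε : ℝ)
    (hθ : 0 ≤ θ) (hIntg : ∀ i, Integrable (fun ω => exp (θ * X i ω)) P) (B : Fin m → ℝ)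
    (hB : ∀ i, mgf (X i) P θ ≤ exp (B i)) :
    P.real {ω | ε ≤ ∑ i, X i ω} ≤ exp (-θ * ε + ∑ i, B i) := by
  have h1 := hi.integrable_exp_mul_sum hX (s := Finset.univ) (t := θ) (fun i _ => hIntg i)
  have h2 := measure_ge_le_exp_mul_mgf ε hθ h1
  rw [hi.mgf_sum hX] at h2
  simp only [Finset.sum_apply] at h2
  refine h2.trans ?_
  rw [exp_add, exp_sum]
  gcongr with i _
  · intro i _; exact mgf_nonneg
  · exact hB i

/-- averaged observations -/
def Yav (m τ : ℕ) (ω : Fin m × Bool × Fin τ → ℝ) (p : Fin m × Bool) : ℝ :=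
  (∑ t, ω (p.1, p.2, t)) / τ

lemma measurable_Yav (m τ : ℕ) : Measurable (Yav m τ) := by
  unfold Yav
  fun_prop

def cf (m τ : ℕ) (w : ℝ) (i : Fin m) (k : Bool) (p : Fin m × Bool × Fin τ) : ℝ :=
  if p.1 = i then
    (if k then (if p.2.1 then w else -(1 - w)) else (if p.2.1 then 1 - w else w)) / τ
  else 0

lemma lin_cf_true (m τ : ℕ) (w : ℝ) (i : Fin m) (ω : Fin m × Bool × Fin τ → ℝ) :
    lin (cf m τ w i true) ω = tg w (Yav m τ ω (i, true)) (Yav m τ ω (i, false)) := by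
  unfold lin cf tg Yav
  simp [Fintype.sum_prod_type, ite_mul, ← Finset.mul_sum]
  ring

lemma lin_cf_false (m τ : ℕ) (w : ℝ) (i : Fin m) (ω : Fin m × Bool × Fin τ → ℝ) :
    lin (cf m τ w i false) ω = th w (Yav m τ ω (i, true)) (Yav m τ ω (i, false)) := by
  unfold lin cf th Yav
  simp [Fintype.sum_prod_type, ite_mul, ← Finset.mul_sum]
  ring

lemma cf_mean (m τ : ℕ) (hτ : 0 < τ) (w : ℝ) (i : Fin m) (a b : Fin m → ℝ) (k : Bool) :
    ∑ p, cf m τ w i k p * (if p.2.1 then a p.1 else b p.1) =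
      if k then tg w (a i) (b i) else th w (a i) (b i) := by
  have : (τ : ℝ) ≠ 0 := by positivity
  unfold cf tg th
  cases k <;>
  · simp [Fintype.sum_prod_type, ite_mul]
    field_simp
    simp [Finset.sum_add_distrib]
    try ring

lemma cf_cross (m τ : ℕ) (w w' : ℝ) (i j : Fin m) (hij : i ≠ j) (k l : Bool) :
    ∑ p, cf m τ w i k p * cf m τ w' j l p = 0 := by
  apply Finset.sum_eq_zero
  intro p _
  unfold cf
  by_cases h : p.1 = i
  · have : p.1 ≠ j := by rw [h]; exact hij
    simp [this]
  · simp [h]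

lemma cf_orth (m τ : ℕ) (w : ℝ) (i : Fin m) :
    ∑ p, cf m τ w i true p * cf m τ w i false p = 0 := by
  unfold cf
  simp [Fintype.sum_prod_type, ite_mul]
  ring

lemma cf_self (m τ : ℕ) (hτ : 0 < τ) (w : ℝ) (i : Fin m) (k : Bool) :
    ∑ p, cf m τ w i k p * cf m τ w i k p = (w ^ 2 + (1 - w) ^ 2) / τ := by
  have : (τ : ℝ) ≠ 0 := by positivity
  unfold cf
  cases k <;>
  · simp [Fintype.sum_prod_type, ite_mul]
    field_simp
    ring

section conc
variable {m τ : ℕ} (hτ : 0 < τ) (v : ℝ≥0) (a b : Fin m → ℝ)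

instance obs_prob (m τ : ℕ) (v : ℝ≥0) (a b : Fin m → ℝ) :
    IsProbabilityMeasure (obsMeasure m τ v a b) := by
  unfold obsMeasure; infer_instance

lemma law_cf (hτ : 0 < τ) (w : ℝ) (i : Fin m) (k : Bool) :
    (obsMeasure m τ v a b).map (lin (cf m τ w i k)) =
      gaussianReal (if k then tg w (a i) (b i) else th w (a i) (b i))
        (v * ((w ^ 2 + (1 - w) ^ 2) / τ)).toNNReal := by
  have := lin_map (fun p : Fin m × Bool × Fin τ => if p.2.1 then a p.1 else b p.1) v
    (cf m τ w i k)
  rw [cf_mean m τ hτ, cf_self m τ hτ] at this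
  exact this

lemma indep_cf (w : Fin m → ℝ) :
    iIndepFun (fun i ω k => lin (cf m τ (w i) i k) ω) (obsMeasure m τ v a b) :=
  lin_blocks (fun p : Fin m × Bool × Fin τ => if p.2.1 then a p.1 else b p.1) v
    (fun i k => cf m τ (w i) i k) (fun i j hij k l => cf_cross m τ _ _ i j hij k l)

lemma orth_cf (w : ℝ) (i : Fin m) :
    IndepFun (lin (cf m τ w i true)) (lin (cf m τ w i false)) (obsMeasure m τ v a b) :=
  lin_indep (fun p : Fin m × Bool × Fin τ => if p.2.1 then a p.1 else b p.1) v _ _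
    (cf_orth m τ w i)

lemma var_bound (S w : ℝ) (hτ : 0 < τ) (hv : v ≠ 0) (hS : (v : ℝ) / τ ≤ S ^ 2)
    (h0 : 0 ≤ w) (h1 : w ≤ 1) :
    (v * ((w ^ 2 + (1 - w) ^ 2) / τ)).toNNReal ≠ 0 ∧
    ((v * ((w ^ 2 + (1 - w) ^ 2) / τ)).toNNReal : ℝ) ≤ S ^ 2 := by
  have hv' : (0 : ℝ) < v := by positivity
  have hτ' : (0 : ℝ) < τ := by positivity
  have hw : 0 < w ^ 2 + (1 - w) ^ 2 := by nlinarith [sq_nonneg (w - 1/2)]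
  have hw1 : w ^ 2 + (1 - w) ^ 2 ≤ 1 := by nlinarith
  have hp : 0 < v * ((w ^ 2 + (1 - w) ^ 2) / τ) := by positivity
  constructor
  · simpa using hp
  · rw [Real.coe_toNNReal _ hp.le]
    refine le_trans ?_ hS
    rw [← mul_div_assoc]
    gcongr
    nlinarith

lemma probA (hτ : 0 < τ) (hv : v ≠ 0) (S : ℝ) (hS0 : 0 < S) (hS : (v : ℝ) / τ ≤ S ^ 2)
    (ha : ∀ i, a i ∈ Set.Icc (0 : ℝ) 1) (hb : ∀ i, b i ∈ Set.Icc (0 : ℝ) 1)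
    (n : ℕ) (hn : n ≤ m ^ 2) (α θ G : ℝ) (hα : α ≤ 1 / 2) (hθ : 0 ≤ θ) (hθ' : θ ≤ 1 / 2) :
    (obsMeasure m τ v a b).real
      {ω | ∑ i, xs m n (Yav m τ ω) i * tg (wt m n i) (a i) (b i) ≤ G} ≤
    exp (θ * G + ∑ i, (-θ / 3 * (2 * α * |tg (wt m n i) (a i) (b i)| - α ^ 2 * S)
      + 4 * θ ^ 2 * S ^ 2)) := by
  set g : Fin m → ℝ := fun i => tg (wt m n i) (a i) (b i) with hg
  let X : Fin m → (Fin m × Bool × Fin τ → ℝ) → ℝ :=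
    fun i ω => -(sg (lin (cf m τ (wt m n i) i true) ω) * g i)
  have hX : ∀ i, Measurable (X i) := fun i =>
    ((measurable_sg.comp (measurable_lin _)).mul_const _).neg
  have hi : iIndepFun X (obsMeasure m τ v a b) :=
    (indep_cf v a b (fun i => wt m n i)).comp (fun i z => -(sg (z true) * g i))
      (fun i => ((measurable_sg.comp (measurable_pi_apply true)).mul_const _).neg)
  have key := chernoff_sum (obsMeasure m τ v a b) X hX hi θ (-G) hθ ?_
    (fun i => (-θ / 3 * (2 * α * |g i| - α ^ 2 * S) + 4 * θ ^ 2 * S ^ 2)) ?_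
  · have e : {ω | ∑ i, xs m n (Yav m τ ω) i * g i ≤ G} = {ω | -G ≤ ∑ i, X i ω} := by
      ext ω
      simp only [Set.mem_ofPred_eq, X, Finset.sum_neg_distrib, neg_le_neg_iff, lin_cf_true, xs]
    rw [e]
    refine key.trans (le_of_eq ?_)
    congr 1; ring
  · intro i
    refine Integrable.of_bound ((hX i).const_mul θ).exp.aestronglyMeasurable
      (exp (θ * |g i|)) (Eventually.of_forall fun ω => ?_)
    rw [Real.norm_eq_abs, abs_exp]
    gcongr
    have := neg_abs_le (sg (lin (cf m τ (wt m n i) i true) ω) * g i)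
    rw [abs_mul, abs_sg, one_mul] at this
    simp only [X]; linarith
  · intro i
    have vb := var_bound (τ := τ) v S (wt m n i) hτ hv hS (wt_nonneg m n i) (wt_le_one m n hn i)
    have h1 := gauss_sg_mgf (g i) S α θ _ vb.1 hS0 vb.2
      (abs_tg_le (wt_nonneg m n i) (wt_le_one m n hn i) (ha i) (hb i)) hα hθ hθ'
    have h2 := law_cf v a b hτ (wt m n i) i true
    simp only [if_true] at h2
    change _ = gaussianReal (g i) _ at h2
    rw [← h2, integral_map (measurable_lin _).aemeasurable] at h1
    · refine le_trans (le_of_eq ?_) h1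
      unfold mgf
      apply integral_congr_ae
      refine Eventually.of_forall fun ω => ?_
      simp only [X]
      congr 1; ring
    · exact (((measurable_sg.mul_const _).const_mul _).exp).aestronglyMeasurable

lemma probB (hτ : 0 < τ) (hv : v ≠ 0) (S : ℝ) (hS : (v : ℝ) / τ ≤ S ^ 2)
    (n : ℕ) (hn : n ≤ m ^ 2) (θ G : ℝ) (hθ : 0 ≤ θ) :
    (obsMeasure m τ v a b).real
      {ω | G ≤ |∑ i, xs m n (Yav m τ ω) i * (th (wt m n i) (Yav m τ ω (i, true))
        (Yav m τ ω (i, false)) - th (wt m n i) (a i) (b i))|} ≤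
    2 * exp (-θ * G + m * (S ^ 2 * θ ^ 2 / 2)) := by
  let X : Fin m → (Fin m × Bool × Fin τ → ℝ) → ℝ := fun i ω =>
    sg (lin (cf m τ (wt m n i) i true) ω) *
      (lin (cf m τ (wt m n i) i false) ω - th (wt m n i) (a i) (b i))
  have hX : ∀ i, Measurable (X i) := fun i =>
    (measurable_sg.comp (measurable_lin _)).mul ((measurable_lin _).sub_const _)
  have hi : iIndepFun X (obsMeasure m τ v a b) :=
    (indep_cf v a b (fun i => wt m n i)).comp
      (fun i z => sg (z true) * (z false - th (wt m n i) (a i) (b i)))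
      (fun i => (measurable_sg.comp (measurable_pi_apply true)).mul
        ((measurable_pi_apply false).sub_const _))
  have hi' : iIndepFun (fun i ω => - X i ω) (obsMeasure m τ v a b) :=
    hi.comp (fun i z => -z) (fun i => measurable_neg)
  have hm : ∀ i (s : ℝ), Integrable (fun ω => exp (s * X i ω)) (obsMeasure m τ v a b) ∧
      mgf (X i) (obsMeasure m τ v a b) s ≤ exp (S ^ 2 * s ^ 2 / 2) := by
    intro i s
    have vb := var_bound (τ := τ) v S (wt m n i) hτ hv hS (wt_nonneg m n i) (wt_le_one m n hn i)
    have h2 := law_cf v a b hτ (wt m n i) i false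
    simp only [Bool.false_eq_true, if_false] at h2
    have h3 := mgf_sign (obsMeasure m τ v a b) _ _ (measurable_lin _) (measurable_lin _)
      (orth_cf v a b (wt m n i) i) _ _ h2 s
    refine ⟨h3.1, h3.2.le.trans ?_⟩
    gcongr
    exact vb.2
  have k1 := chernoff_sum (obsMeasure m τ v a b) X hX hi θ G hθ (fun i => (hm i θ).1)
    (fun i => S ^ 2 * θ ^ 2 / 2) (fun i => (hm i θ).2)
  have k2 := chernoff_sum (obsMeasure m τ v a b) (fun i ω => - X i ω) (fun i => (hX i).neg) hi'
    θ G hθ (fun i => by simpa using (hm i (-θ)).1)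
    (fun i => S ^ 2 * θ ^ 2 / 2) (fun i => by
      have := (hm i (-θ)).2
      have e : mgf (fun ω => - X i ω) (obsMeasure m τ v a b) θ =
        mgf (X i) (obsMeasure m τ v a b) (-θ) := by simp [mgf]
      rw [e]; simpa using this)
  have sub : {ω | G ≤ |∑ i, xs m n (Yav m τ ω) i * (th (wt m n i) (Yav m τ ω (i, true))
        (Yav m τ ω (i, false)) - th (wt m n i) (a i) (b i))|} ⊆
      {ω | G ≤ ∑ i, X i ω} ∪ {ω | G ≤ ∑ i, - X i ω} := by
    intro ω hω
    simp only [Set.mem_ofPred_eq, Set.mem_union, X, Finset.sum_neg_distrib, lin_cf_true,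
      lin_cf_false, xs] at hω ⊢
    exact le_abs.1 hω
  refine (measureReal_mono sub).trans ((measureReal_union_le _ _).trans ?_)
  simp only [Finset.sum_const, Finset.card_univ, Fintype.card_fin, nsmul_eq_mul] at k1 k2
  linarith
end conc

lemma measurable_Dh (m : ℕ) (G : ℝ) (n : ℕ) : Measurable (Dh m G n) := by
  unfold Dh xs tg th
  refine Measurable.sub_const (Finset.measurable_fun_sum _ fun i _ => ?_) _
  exact (measurable_sg.comp (by fun_prop)).mul (by fun_prop)

lemma Nsel_eq_iff (m : ℕ) (G : ℝ) (y : Fin m × Bool → ℝ) (n : ℕ) :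
    Nsel m G y = n ↔ ((n ≤ m ^ 2 ∧ 0 ≤ Dh m G n y) ∧ ∀ k < n, ¬ (k ≤ m ^ 2 ∧ 0 ≤ Dh m G k y)) ∨
      ((∀ k, ¬ (k ≤ m ^ 2 ∧ 0 ≤ Dh m G k y)) ∧ n = m ^ 2) := by
  unfold Nsel
  split_ifs with h
  · rw [Nat.find_eq_iff]
    constructor
    · intro h'; exact Or.inl h'
    · rintro (h' | h')
      · exact h'
      · exact absurd h (not_exists.2 h'.1)
  · constructor
    · intro h'; exact Or.inr ⟨not_exists.1 h, h'.symm⟩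
    · rintro (h' | h')
      · exact absurd ⟨n, h'.1⟩ h
      · exact h'.2.symm

lemma measurable_Nsel (m : ℕ) (G : ℝ) : Measurable (Nsel m G) := by
  refine measurable_to_countable' fun n => ?_
  have hD : ∀ k, MeasurableSet {y : Fin m × Bool → ℝ | k ≤ m ^ 2 ∧ 0 ≤ Dh m G k y} := fun k =>
    (MeasurableSet.const _).inter (measurableSet_le measurable_const (measurable_Dh m G k))
  have e : Nsel m G ⁻¹' {n} =
      ({y | n ≤ m ^ 2 ∧ 0 ≤ Dh m G n y} ∩ ⋂ k, {y | k < n → ¬ (k ≤ m ^ 2 ∧ 0 ≤ Dh m G k y)}) ∪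
      ((⋂ k, {y | ¬ (k ≤ m ^ 2 ∧ 0 ≤ Dh m G k y)}) ∩ {_y | n = m ^ 2}) := by
    ext y
    simp only [Set.mem_preimage, Set.mem_singleton_iff, Nsel_eq_iff, Set.mem_union, Set.mem_inter_iff,
      Set.mem_iInter, Set.mem_ofPred_eq]
  rw [e]
  refine (((hD n).inter (MeasurableSet.iInter fun k => ?_))).union
    ((MeasurableSet.iInter fun k => (hD k).compl).inter (MeasurableSet.const _))
  by_cases hk : k < n
  · simp only [hk, true_imp_iff]; exact (hD k).compl
  · simp [hk]

lemma meas_alloc (m τ : ℕ) (G : ℝ) (A : Finset (Fin m)) :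
    MeasurableSet {ω | allocY m G (Yav m τ ω) = A} := by
  have h1 : MeasurableSet {y | allocY m G y = A} := by
    have e : {y | allocY m G y = A} = ⋃ n, (Nsel m G ⁻¹' {n} ∩ {y | allocN m n y = A}) := by
      ext y
      simp [allocY]
    rw [e]
    refine MeasurableSet.iUnion fun n => (measurable_Nsel m G (measurableSet_singleton n)).inter ?_
    have e2 : {y | allocN m n y = A} = ⋂ i, {y | 0 < tg (wt m n i) (y (i, true)) (y (i, false))
        ↔ i ∈ A} := by
      ext y
      simp [allocN, Finset.ext_iff]
    rw [e2]
    refine MeasurableSet.iInter fun i => ?_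
    have h0 : MeasurableSet {y : Fin m × Bool → ℝ |
        0 < tg (wt m n i) (y (i, true)) (y (i, false))} := by
      unfold tg
      exact measurableSet_lt measurable_const (by fun_prop)
    by_cases hi : i ∈ A
    · simpa [hi] using h0
    · simp only [hi, iff_false]; exact h0.compl
  exact measurable_Yav m τ h1

lemma success_bound {m τ : ℕ} (hm : 32 ≤ m) (hτ : 0 < τ) (v : ℝ≥0) (hv : v ≠ 0)
    (a b : Fin m → ℝ)
    (ha : ∀ i, a i ∈ Set.Icc (0 : ℝ) 1) (hb : ∀ i, b i ∈ Set.Icc (0 : ℝ) 1)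
    (Δ : ℝ) (hopt : optEnvy a b ≤ -Δ)
    (S : ℝ) (hS0 : 0 < S) (hS : (v : ℝ) / τ ≤ S ^ 2) (α θ φ G : ℝ) (hα0 : 0 ≤ α) (hα : α ≤ 1 / 2)
    (hθ : 0 ≤ θ) (hθ' : θ ≤ 1 / 2) (hφ : 0 ≤ φ) (hG : 48 ≤ G) :
    1 - ((m : ℝ) ^ 2 + 1) * (exp (θ * G - θ / 3 * (2 * α * (Δ - 2) - α ^ 2 * S * m)
        + 4 * θ ^ 2 * S ^ 2 * m) + 2 * exp (-φ * (G / 8) + m * (S ^ 2 * φ ^ 2 / 2))) ≤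
    (obsMeasure m τ v a b).real {ω | envy a b (allocY m G (Yav m τ ω)) ≤ 0} := by
  set P := obsMeasure m τ v a b
  set eA := exp (θ * G - θ / 3 * (2 * α * (Δ - 2) - α ^ 2 * S * m) + 4 * θ ^ 2 * S ^ 2 * m)
  set eB := exp (-φ * (G / 8) + m * (S ^ 2 * φ ^ 2 / 2))
  let FA : ℕ → Set (Fin m × Bool × Fin τ → ℝ) := fun n =>
    {ω | ∑ i, xs m n (Yav m τ ω) i * tg (wt m n i) (a i) (b i) ≤ G}
  let FB : ℕ → Set (Fin m × Bool × Fin τ → ℝ) := fun n =>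
    {ω | G / 8 ≤ |∑ i, xs m n (Yav m τ ω) i * (th (wt m n i) (Yav m τ ω (i, true))
        (Yav m τ ω (i, false)) - th (wt m n i) (a i) (b i))|}
  have hA : ∀ n ≤ m ^ 2, P.real (FA n) ≤ eA := by
    intro n hn
    refine (probA v a b hτ hv S hS0 hS ha hb n hn α θ G hα hθ hθ').trans ?_
    apply exp_le_exp.2
    have h1 := sum_tg_ge (by omega) Δ a b ha hb hopt n hn
    rw [Finset.sum_add_distrib, ← Finset.mul_sum, Finset.sum_sub_distrib, ← Finset.mul_sum]
    simp only [Finset.sum_const, Finset.card_univ, Fintype.card_fin, nsmul_eq_mul]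
    have h2 : θ / 3 * (2 * α * (Δ - 2)) ≤
        θ / 3 * (2 * α * ∑ i, |tg (wt m n i) (a i) (b i)|) := by gcongr
    nlinarith [h2]
  have hB : ∀ n ≤ m ^ 2, P.real (FB n) ≤ 2 * eB := fun n hn =>
    probB v a b hτ hv S hS n hn φ (G / 8) hφ
  let F := ⋃ n ∈ Finset.range (m ^ 2 + 1), (FA n ∪ FB n)
  have hF : P.real F ≤ ((m : ℝ) ^ 2 + 1) * (eA + 2 * eB) := by
    refine (measureReal_biUnion_finset_le _ _).trans ?_
    refine (Finset.sum_le_card_nsmul _ _ (eA + 2 * eB) ?_).trans (le_of_eq ?_)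
    · intro n hn
      have hn' : n ≤ m ^ 2 := by simpa [Nat.lt_succ_iff] using hn
      exact (measureReal_union_le _ _).trans (add_le_add (hA n hn') (hB n hn'))
    · simp only [Finset.card_range, nsmul_eq_mul]; push_cast; ring
  have hsub : Fᶜ ⊆ {ω | envy a b (allocY m G (Yav m τ ω)) ≤ 0} := by
    intro ω hω
    have hω' : ∀ n ≤ m ^ 2, ω ∉ FA n ∧ ω ∉ FB n := by
      intro n hn
      constructor <;> intro hc <;> apply hω <;> simp only [F, Set.mem_iUnion] <;>
        refine ⟨n, by simpa [Nat.lt_succ_iff] using hn, ?_⟩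
      · exact Or.inl hc
      · exact Or.inr hc
    refine det_good hm G hG (Yav m τ ω) a b ha hb ?_ ?_
    · intro n hn
      exact (not_le.1 (hω' n hn).1).le
    · intro n hn
      exact (not_le.1 (hω' n hn).2).le
  have h1 : 1 ≤ P.real F + P.real Fᶜ := by
    have := measureReal_union_le (μ := P) F Fᶜ
    simpa using this
  have h2 := measureReal_mono (μ := P) hsub
  linarith

def Gm (m : ℕ) (D : ℝ) : ℝ := D * √(Real.log m) / (12 * (m : ℝ) ^ ((1 : ℝ) / 4))

set_option maxHeartbeats 1600000 in
lemma param_bound {m : ℕ} (hL : 100 ≤ Real.log m) (hL2 : 16 * Real.log m ^ 2 ≤ m) (D σ : ℝ)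
    (hσ : 0 < σ) (hD : (m : ℝ) ^ ((1 : ℝ) / 4) * Real.log m ^ 2 ≤ D) (τ : ℕ)
    (hτ : τ = ⌈σ ^ 2 * (15 * ((m : ℝ) ^ ((3 : ℝ) / 2) / D ^ 2) * Real.log m
      + Real.log m ^ 2)⌉₊) (a b : Fin m → ℝ)
    (ha : ∀ i, a i ∈ Set.Icc (0 : ℝ) 1) (hb : ∀ i, b i ∈ Set.Icc (0 : ℝ) 1)
    (hopt : optEnvy a b ≤ -D) :
    1 - 6 * exp 73728 / (m : ℝ) ^ 2 ≤
      (obsMeasure m τ (σ ^ 2).toNNReal a b).real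
        {ω | envy a b (allocY m (Gm m D) (Yav m τ ω)) ≤ 0} := by
  have hm1 : (160000 : ℝ) ≤ m := by nlinarith
  have hm32 : 32 ≤ m := by
    have : (32 : ℝ) ≤ m := by linarith
    exact_mod_cast this
  have hm0 : (0 : ℝ) < m := by linarith
  obtain ⟨r, hr⟩ : ∃ r, r = (m : ℝ) ^ ((1 : ℝ) / 4) := ⟨_, rfl⟩
  have hr0 : 0 < r := by rw [hr]; positivity
  have hr4 : r ^ 4 = m := by
    rw [hr, ← Real.rpow_natCast, ← Real.rpow_mul hm0.le]; norm_num
  have hr6 : (m : ℝ) ^ ((3 : ℝ) / 2) = r ^ 6 := by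
    rw [hr, ← Real.rpow_natCast, ← Real.rpow_mul hm0.le]; norm_num
  have hexp : exp (-(4 * Real.log m)) = 1 / (m : ℝ) ^ 4 := by
    have h : 4 * Real.log m = Real.log ((m : ℝ) ^ 4) := by rw [Real.log_pow]; norm_num
    rw [exp_neg, h, exp_log (by positivity), one_div]
  have hGm : Gm m D = D * √(Real.log m) / (12 * r) := by rw [Gm, hr]
  rw [hr6] at hτ
  rw [← hr] at hD
  rw [hGm]
  obtain ⟨L, hLe⟩ : ∃ L, L = Real.log m := ⟨_, rfl⟩
  rw [← hLe] at hL hL2 hD hτ hexp ⊢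
  obtain ⟨s, hs⟩ : ∃ s, s = √L := ⟨_, rfl⟩
  rw [← hs]
  have hs2 : s ^ 2 = L := by rw [hs]; exact Real.sq_sqrt (by linarith)
  have hs10 : 10 ≤ s := by
    rw [hs]; apply Real.le_sqrt_of_sq_le; linarith
  have hs0 : 0 < s := by linarith
  have hL0 : 0 < L := by linarith
  have hr1 : 2 * s ≤ r := by
    have : (2 * s) ^ 4 ≤ r ^ 4 := by rw [hr4]; nlinarith
    exact le_of_pow_le_pow_left₀ (by norm_num) hr0.le this
  have hD8 : 8 ≤ D := by nlinarith
  have hD0 : 0 < D := by linarith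
  set S := D / (r ^ 3 * s) with hS
  set G := D * s / (12 * r) with hG
  have hS0 : 0 < S := by positivity
  have hGs : s ^ 5 / 12 ≤ G := by
    rw [hG, div_le_div_iff₀ (by norm_num) (by positivity)]
    have : r * s ^ 4 ≤ D := by
      have : s ^ 4 = L ^ 2 := by rw [← hs2]; ring
      rw [this]; exact hD
    nlinarith [mul_le_mul_of_nonneg_right this hs0.le]
  have hs3 : 1000 ≤ s ^ 3 := by
    have := pow_le_pow_left₀ (by norm_num) hs10 3
    linarith
  have hG8 : 8 * L ≤ G := by
    refine le_trans ?_ hGs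
    rw [← hs2]
    nlinarith [sq_nonneg s, mul_le_mul_of_nonneg_right hs3 (sq_nonneg s)]
  have hG48 : 48 ≤ G := by linarith
  have hG0 : 0 < G := by linarith
  have hτpos : 0 < τ := by
    rw [hτ]; apply Nat.ceil_pos.2; positivity
  have hτ0 : (0 : ℝ) < τ := by exact_mod_cast hτpos
  have hτge : σ ^ 2 * (r ^ 6 / D ^ 2 * L) ≤ τ := by
    rw [hτ]
    refine le_trans ?_ (Nat.le_ceil _)
    gcongr
    have : 0 ≤ r ^ 6 / D ^ 2 * L := by positivity
    nlinarith [sq_nonneg L]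
  have hSv : ((σ ^ 2).toNNReal : ℝ) / τ ≤ S ^ 2 := by
    rw [Real.coe_toNNReal _ (sq_nonneg σ), div_le_iff₀ hτ0]
    refine le_trans (le_of_eq ?_) (mul_le_mul_of_nonneg_left hτge (sq_nonneg S))
    rw [hS, ← hs2]; field_simp
  have hSm : S ^ 2 * m = 144 * G ^ 2 / L ^ 2 := by
    rw [hS, hG, ← hs2, ← hr4]; field_simp; norm_num
  have key := success_bound hm32 hτpos (σ ^ 2).toNNReal (by simp; positivity) a b ha hb D hopt S hS0
    hSv (s / r) (4 * L / G) (32 * L / G) G (by positivity)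
    (by rw [div_le_div_iff₀ hr0 (by norm_num)]; linarith) (by positivity)
    (by rw [div_le_div_iff₀ hG0 (by norm_num)]; linarith) (by positivity) hG48
  refine le_trans ?_ key
  have e1 : 4 * L / G * G - 4 * L / G / 3 * (2 * (s / r) * (D - 2) - (s / r) ^ 2 * S * m)
        + 4 * (4 * L / G) ^ 2 * S ^ 2 * m ≤ -(4 * L) + 73728 := by
    have h1 : (s / r) ^ 2 * S * m = s / r * D := by
      rw [hS, ← hr4]; field_simp
    have h2 : 4 * (4 * L / G) ^ 2 * S ^ 2 * m = 9216 := by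
      rw [mul_assoc, hSm]; field_simp; norm_num
    have h3 : 6 * G ≤ 2 * (s / r) * (D - 2) - s / r * D := by
      have : 6 * G = s / r * (D / 2) := by rw [hG]; field_simp; norm_num
      rw [this]
      have h0 : 0 ≤ s / r := by positivity
      have h7 := mul_le_mul_of_nonneg_left (show D / 2 ≤ D - 4 by linarith) h0
      refine h7.trans (le_of_eq ?_)
      ring
    rw [h1, h2]
    have h4 : 4 * L / G / 3 * (6 * G) ≤ 4 * L / G / 3 * (2 * (s / r) * (D - 2) - s / r * D) := by
      gcongr
    have h5 : 4 * L / G / 3 * (6 * G) = 8 * L := by field_simp; norm_num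
    have h6 : 4 * L / G * G = 4 * L := by field_simp
    linarith
  have e2 : -(32 * L / G) * (G / 8) + m * (S ^ 2 * (32 * L / G) ^ 2 / 2) = -(4 * L) + 73728 := by
    have : (m : ℝ) * (S ^ 2 * (32 * L / G) ^ 2 / 2) = (S ^ 2 * m) * ((32 * L / G) ^ 2 / 2) := by ring
    rw [this, hSm]; field_simp; ring
  rw [e2]
  have e3 := exp_le_exp.2 e1
  have e4 : exp (-(4 * L) + 73728) = exp 73728 / (m : ℝ) ^ 4 := by
    rw [exp_add, hexp]; ring
  have e5 : ((m : ℝ) ^ 2 + 1) ≤ 2 * (m : ℝ) ^ 2 := by nlinarith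
  have e6 : ((m : ℝ) ^ 2 + 1) * (3 * exp (-(4 * L) + 73728)) ≤ 6 * exp 73728 / (m : ℝ) ^ 2 := by
    refine (mul_le_mul_of_nonneg_right e5 (by positivity)).trans (le_of_eq ?_)
    rw [e4]; field_simp; norm_num
  have e7 := mul_le_mul_of_nonneg_left e3 (show 0 ≤ (m : ℝ) ^ 2 + 1 by positivity)
  nlinarith [e6, e7]

lemma exists_profile {m : ℕ} (D : ℝ) (hD : D ≤ (m / 2 : ℕ)) :
    ∃ p : (Fin m → ℝ) × (Fin m → ℝ), (∀ i, p.1 i ∈ Set.Icc (0 : ℝ) 1) ∧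
      (∀ i, p.2 i ∈ Set.Icc (0 : ℝ) 1) ∧ optEnvy p.1 p.2 ≤ -D := by
  let A : Finset (Fin m) := Finset.univ.filter fun i => i.val < m / 2
  have hA : A.card = m / 2 := by
    have h := Fin.card_filter_val_lt (n := m) (m := m / 2)
    have h2 : A.card = min m (m / 2) := by convert h
    omega
  have hAc : Aᶜ.card = m - m / 2 := by rw [Finset.card_compl, hA, Fintype.card_fin]
  refine ⟨(fun i => if i ∈ A then 1 else 0, fun i => if i ∈ A then 0 else 1), ?_, ?_, ?_⟩
  · intro i; dsimp only; split_ifs <;> simp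
  · intro i; dsimp only; split_ifs <;> simp
  · refine (ciInf_le (Set.finite_range _).bddBelow A).trans ?_
    have h1 : ∑ i ∈ Aᶜ, (if i ∈ A then (1 : ℝ) else 0) = 0 :=
      Finset.sum_eq_zero fun i hi => if_neg (Finset.mem_compl.1 hi)
    have h2 : ∑ i ∈ A, (if i ∈ A then (1 : ℝ) else 0) = (m / 2 : ℕ) := by
      rw [Finset.sum_congr rfl fun i hi => if_pos hi]; simp [hA]
    have h3 : ∑ i ∈ A, (if i ∈ A then (0 : ℝ) else 1) = 0 :=
      Finset.sum_eq_zero fun i hi => if_pos hi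
    have h4 : ∑ i ∈ Aᶜ, (if i ∈ A then (0 : ℝ) else 1) = (m - m / 2 : ℕ) := by
      rw [Finset.sum_congr rfl fun i hi => if_neg (Finset.mem_compl.1 hi)]; simp [hAc]
    have h5 : ((m / 2 : ℕ) : ℝ) ≤ (m - m / 2 : ℕ) := by
      exact_mod_cast (by omega : m / 2 ≤ m - m / 2)
    unfold envy envyAB envyBA
    dsimp only
    rw [h1, h2, h3, h4]
    apply max_le <;> linarith

/-- with noise variance `σ(m)²`,
`q(m) = m ⌈σ(m)² (15 (m^{3/2}/Δ(m)²) log m + (log m)²)⌉` queries (i.e. `τ(m) = q(m)/m`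
samples per item and agent) suffice: there is a measurable allocation rule whose worst-case
(over profiles with `OptEnvy ≤ -Δ(m)`) probability of outputting an envy-free allocation
tends to `1`. -/
theorem stmt2 (σ : ℕ → ℝ) (hσ : ∀ m, 0 < σ m) (Δ : ℕ → ℝ)
    (hΔ1 : ∀ᶠ m : ℕ in atTop, (m : ℝ) ^ ((1 : ℝ) / 4) * Real.log m ^ 2 ≤ Δ m)
    (hΔ2 : Tendsto (fun m : ℕ => Δ m * Real.log m / m) atTop (nhds 0))
    (τ : ℕ → ℕ)
    (hτ : ∀ m : ℕ,
      τ m = ⌈σ m ^ 2 * (15 * ((m : ℝ) ^ ((3 : ℝ) / 2) / Δ m ^ 2) * Real.log m + Real.log m ^ 2)⌉₊) :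
    ∃ alloc : (m : ℕ) → ((Fin m × Bool × Fin (τ m)) → ℝ) → Finset (Fin m),
      (∀ m (A : Finset (Fin m)), MeasurableSet {ω | alloc m ω = A}) ∧
      Tendsto (fun m : ℕ =>
          ⨅ p : {p : (Fin m → ℝ) × (Fin m → ℝ) //
              (∀ i, p.1 i ∈ Set.Icc (0 : ℝ) 1) ∧ (∀ i, p.2 i ∈ Set.Icc (0 : ℝ) 1) ∧
              optEnvy p.1 p.2 ≤ -Δ m},
            (obsMeasure m (τ m) (σ m ^ 2).toNNReal p.val.1 p.val.2
                {ω | envy p.val.1 p.val.2 (alloc m ω) ≤ 0}).toReal)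
        atTop (nhds 1) := by

  refine ⟨fun m ω => allocY m (Gm m (Δ m)) (Yav m (τ m) ω), fun m A => meas_alloc m (τ m) _ A, ?_⟩
  have hlog : Tendsto (fun m : ℕ => Real.log m) atTop atTop :=
    Real.tendsto_log_atTop.comp tendsto_natCast_atTop_atTop
  have hlog2 : ∀ᶠ m : ℕ in atTop, 16 * Real.log m ^ 2 ≤ m := by
    have h0 := (isLittleO_pow_log_id_atTop (n := 2)).bound (show (0 : ℝ) < 1 / 16 by norm_num)
    have h := tendsto_natCast_atTop_atTop.eventually h0
    filter_upwards [h] with m hm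
    simp only [id, Real.norm_eq_abs, abs_pow, sq_abs, Nat.abs_cast] at hm
    linarith
  have hne : ∀ᶠ m : ℕ in atTop, Δ m ≤ (m / 2 : ℕ) := by
    filter_upwards [hΔ2.eventually (gt_mem_nhds (show (0 : ℝ) < 1 by norm_num)),
      hlog.eventually_ge_atTop 4, eventually_ge_atTop 4] with m h1 h2 h3
    have hm0 : (4 : ℝ) ≤ m := by exact_mod_cast h3
    rw [div_lt_one (by linarith)] at h1
    have h4 : (m : ℝ) / 4 ≤ (m / 2 : ℕ) := by
      have : m ≤ 4 * (m / 2) := by omega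
      have : (m : ℝ) ≤ 4 * ((m / 2 : ℕ) : ℝ) := by exact_mod_cast this
      linarith
    refine le_trans ?_ h4
    by_contra hc
    push Not at hc
    nlinarith
  have hlim : Tendsto (fun m : ℕ => 1 - 6 * exp 73728 / (m : ℝ) ^ 2) atTop (nhds 1) := by
    have h1 : Tendsto (fun m : ℕ => (m : ℝ) ^ 2) atTop atTop :=
      (tendsto_pow_atTop (by norm_num)).comp tendsto_natCast_atTop_atTop
    simpa using (h1.const_div_atTop (6 * exp 73728)).const_sub 1
  refine tendsto_of_tendsto_of_tendsto_of_le_of_le' hlim tendsto_const_nhds ?_ ?_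
  · filter_upwards [hΔ1, hne, hlog.eventually_ge_atTop 100, hlog2] with m h1 h2 h3 h4
    obtain ⟨p, hp⟩ := exists_profile (Δ m) h2
    haveI : Nonempty {p : (Fin m → ℝ) × (Fin m → ℝ) //
              (∀ i, p.1 i ∈ Set.Icc (0 : ℝ) 1) ∧ (∀ i, p.2 i ∈ Set.Icc (0 : ℝ) 1) ∧
              optEnvy p.1 p.2 ≤ -Δ m} := ⟨⟨p, hp⟩⟩
    refine le_ciInf fun q => ?_
    exact param_bound h3 h4 (Δ m) (σ m) (hσ m) h1 (τ m) (hτ m) q.1.1 q.1.2 q.2.1 q.2.2.1 q.2.2.2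
  · filter_upwards [hne] with m h2
    obtain ⟨p, hp⟩ := exists_profile (Δ m) h2
    refine (ciInf_le ⟨0, ?_⟩ ⟨p, hp⟩).trans ?_
    · rintro _ ⟨q, rfl⟩
      exact ENNReal.toReal_nonneg
    · exact measureReal_le_one
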